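/- Let f : ℝ^d → ℝ be L-smooth. Let x_t, u_t be F_t-measurable random vectors and set x_{t+1} = x_t − α_t(∇f(u_t) − ζ_t), where α_t > 0 is deterministic with α_t L ≤ 1, and the noise ζ_t satisfies E[ζ_t | F_t] = 0 and E[‖ζ_t‖² | F_t] ≤ σ². Then almost surely: 2 E[f(x_{t+1}) | F_t] ≤ 2 f(x_t) − α_t ‖∇f(x_t)‖² + α_t ‖∇f(x_t) − ∇f(u_t)‖² + α_t² L σ². -/

import Mathlib

open MeasureTheory

/-- The quadratic upper bound for a function with `L`-Lipschitz gradient. -/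
theorem le_add_inner_gradient_add_of_gradient_lipschitz {E : Type*} [NormedAddCommGroup E]
    [InnerProductSpace ℝ E] [CompleteSpace E] {f : E → ℝ} {L : ℝ} (hdiff : Differentiable ℝ f)
    (hlip : ∀ x y, ‖gradient f x - gradient f y‖ ≤ L * ‖x - y‖) (x v : E) :
    f (x + v) ≤ f x + inner ℝ (gradient f x) v + L / 2 * ‖v‖ ^ 2 := by
  have hline (s : ℝ) : HasDerivAt (fun s : ℝ => x + s • v) v s := by
    simpa using ((hasDerivAt_id s).smul_const v).const_add x
  have hf (s : ℝ) :
      HasDerivAt (fun s : ℝ => f (x + s • v)) (inner ℝ (gradient f (x + s • v)) v) s := by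
    simpa [Function.comp_def] using
      ((hdiff (x + s • v)).hasGradientAt.hasFDerivAt).comp_hasDerivAt s (hline s)
  have hB (s : ℝ) :
      HasDerivAt (fun s : ℝ => f x + s * inner ℝ (gradient f x) v + s ^ 2 * (L / 2 * ‖v‖ ^ 2))
        (inner ℝ (gradient f x) v + s * (L * ‖v‖ ^ 2)) s := by
    refine HasDerivAt.congr_deriv ((((hasDerivAt_id s).mul_const (inner ℝ (gradient f x) v)).const_add (f x)).add
      ((hasDerivAt_pow 2 s).mul_const (L / 2 * ‖v‖ ^ 2))) ?_
    push_cast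
    ring
  have key := image_le_of_deriv_right_le_deriv_boundary (a := 0) (b := 1)
    (fun s _ => (hf s).continuousAt.continuousWithinAt) (fun s _ => (hf s).hasDerivWithinAt)
    (by simp) (fun s _ => (hB s).continuousAt.continuousWithinAt)
    (fun s _ => (hB s).hasDerivWithinAt) (fun s hs => ?_)
    (Set.right_mem_Icc.2 zero_le_one)
  · simpa using key
  · have h1 := real_inner_le_norm (gradient f (x + s • v) - gradient f x) v
    have h2 : ‖gradient f (x + s • v) - gradient f x‖ ≤ L * (s * ‖v‖) := by
      simpa [norm_smul, abs_of_nonneg hs.1] using hlip (x + s • v) x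
    rw [inner_sub_left] at h1
    nlinarith [mul_le_mul_of_nonneg_right h2 (norm_nonneg v)]

/-- A conditional bound for an integrable variable dominated by an `m`-measurable variable plus the
inner product of an `m`-measurable vector with conditionally centred noise. Neither the bound nor
the inner product needs to be integrable. -/
theorem condExp_le_of_le_add_inner {Ω E : Type*} [NormedAddCommGroup E] [InnerProductSpace ℝ E]
    [CompleteSpace E] {m m0 : MeasurableSpace Ω} {μ : Measure Ω} [IsFiniteMeasure μ] (hm : m ≤ m0)
    {Z h : Ω → ℝ} {V ζ : Ω → E} (hZ : Integrable Z μ) (hh : StronglyMeasurable[m] h)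
    (hV : StronglyMeasurable[m] V) (hζ : Integrable ζ μ) (hζ0 : μ[ζ | m] =ᵐ[μ] 0)
    (hle : ∀ᵐ ω ∂μ, Z ω ≤ h ω + inner ℝ (V ω) (ζ ω)) :
    μ[Z | m] ≤ᵐ[μ] h := by
  let s : ℕ → Set Ω := fun n => {ω | ‖h ω‖ ≤ n} ∩ {ω | ‖V ω‖ ≤ n}
  have hs (n : ℕ) : MeasurableSet[m] (s n) :=
    (hh.norm.measurableSet_le stronglyMeasurable_const).inter
      (hV.norm.measurableSet_le stronglyMeasurable_const)
  suffices H : ∀ n, ∀ᵐ ω ∂μ, ω ∈ s n → (μ[Z | m]) ω ≤ h ω by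
    filter_upwards [ae_all_iff.2 H] with ω hω
    obtain ⟨n, hn⟩ := exists_nat_ge (max ‖h ω‖ ‖V ω‖)
    exact hω n ⟨(le_max_left _ _).trans hn, (le_max_right _ _).trans hn⟩
  intro n
  have hhm : StronglyMeasurable[m] ((s n).indicator h) := hh.indicator (hs n)
  have hVm : StronglyMeasurable[m] ((s n).indicator V) := hV.indicator (hs n)
  have hhi : Integrable ((s n).indicator h) μ := by
    refine .of_bound (hhm.mono hm).aestronglyMeasurable n (ae_of_all _ fun ω => ?_)
    by_cases hω : ω ∈ s n
    · simpa [hω] using hω.1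
    · simp [hω]
  have hVi : Integrable (fun ω => inner ℝ ((s n).indicator V ω) (ζ ω)) μ := by
    refine (hζ.norm.const_mul (n : ℝ)).mono'
      ((hVm.mono hm).aestronglyMeasurable.inner hζ.aestronglyMeasurable)
      (ae_of_all _ fun ω => (norm_inner_le_norm _ _).trans ?_)
    gcongr
    by_cases hω : ω ∈ s n
    · simpa [hω] using hω.2
    · simp [hω]
  have hpull := condExp_bilin_of_stronglyMeasurable_left (innerSL ℝ) hVm hVi hζ
  have hmono := condExp_mono (m := m) (hZ.indicator (hm _ (hs n))) (hhi.add hVi) (by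
    filter_upwards [hle] with ω hω
    by_cases hωs : ω ∈ s n
    · simpa [hωs] using hω
    · simp [hωs])
  filter_upwards [hmono, condExp_indicator hZ (hs n), condExp_add hhi hVi m, hpull, hζ0]
    with ω h1 h2 h3 h4 h5 hω
  rw [h2, h3, Pi.add_apply, condExp_of_stronglyMeasurable hm hhm hhi] at h1
  change (μ[fun ω => inner ℝ ((s n).indicator V ω) (ζ ω) | m]) ω =
    inner ℝ ((s n).indicator V ω) ((μ[ζ | m]) ω) at h4
  rw [h4, h5] at h1
  simpa [hω] using h1

/-- For `f : ℝ^d → ℝ` `L`-smooth, `Fₜ`-measurable `xₜ, uₜ`, step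
`x_{t+1} = xₜ − αₜ(∇f(uₜ) − ζₜ)` with deterministic `αₜ > 0`, `αₜ L ≤ 1`, and noise `ζₜ`
(`F_{t+1}`-measurable) satisfying `E[ζₜ|Fₜ] = 0` and `E[‖ζₜ‖²|Fₜ] ≤ σ²`, one has almost surely
`2E[f(x_{t+1})|Fₜ] ≤ 2f(xₜ) − αₜ‖∇f(xₜ)‖² + αₜ‖∇f(xₜ) − ∇f(uₜ)‖² + αₜ²Lσ²`. -/
theorem sgd_one_step_conditional_descent {d : ℕ}
    {Ω : Type*} {m0 : MeasurableSpace Ω} (μ : Measure Ω) [IsProbabilityMeasure μ]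
    (ℱ : Filtration ℕ m0)
    (f : EuclideanSpace ℝ (Fin d) → ℝ) (L : ℝ) (hL : 0 < L)
    (hdiff : Differentiable ℝ f)
    (hlip : ∀ x y, ‖gradient f x - gradient f y‖ ≤ L * ‖x - y‖)
    (x u ζ : ℕ → Ω → EuclideanSpace ℝ (Fin d))
    (α : ℕ → ℝ) (σ : ℝ)
    (hα : ∀ t, 0 < α t) (hαL : ∀ t, α t * L ≤ 1)
    (hxad : ∀ t, StronglyMeasurable[ℱ t] (x t))
    (huad : ∀ t, StronglyMeasurable[ℱ t] (u t))
    (hζad : ∀ t, StronglyMeasurable[ℱ (t + 1)] (ζ t))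
    (hrec : ∀ t, x (t + 1) = fun ω => x t ω - α t • (gradient f (u t ω) - ζ t ω))
    (hζint : ∀ t, Integrable (ζ t) μ)
    (hζmean : ∀ t, μ[ζ t | ℱ t] =ᵐ[μ] 0)
    (hζsqint : ∀ t, Integrable (fun ω => ‖ζ t ω‖ ^ 2) μ)
    (hζvar : ∀ t, ∀ᵐ ω ∂μ, (μ[fun ω' => ‖ζ t ω'‖ ^ 2 | ℱ t]) ω ≤ σ ^ 2)
    (hfint : ∀ t, Integrable (fun ω => f (x t ω)) μ)
    (t : ℕ) :
    ∀ᵐ ω ∂μ,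
      2 * (μ[fun ω' => f (x (t + 1) ω') | ℱ t]) ω
        ≤ 2 * f (x t ω) - α t * ‖gradient f (x t ω)‖ ^ 2
          + α t * ‖gradient f (x t ω) - gradient f (u t ω)‖ ^ 2
          + (α t) ^ 2 * L * σ ^ 2 := by
  have hm := ℱ.le t
  have hgrad : Continuous (gradient f) :=
    (LipschitzWith.of_dist_le_mul (K := ⟨L, hL.le⟩) fun a b => by
      rw [dist_eq_norm, dist_eq_norm]
      exact hlip a b).continuous
  have hgx : StronglyMeasurable[ℱ t] fun ω => gradient f (x t ω) :=
    hgrad.comp_stronglyMeasurable (hxad t)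
  have hgu : StronglyMeasurable[ℱ t] fun ω => gradient f (u t ω) :=
    hgrad.comp_stronglyMeasurable (huad t)
  have hY := (hfint (t + 1)).const_mul 2
  have hQ := (hζsqint t).const_mul ((α t) ^ 2 * L)
  have key := condExp_le_of_le_add_inner hm (hY.sub hQ)
    (h := fun ω => 2 * f (x t ω) - α t * ‖gradient f (x t ω)‖ ^ 2
          + α t * ‖gradient f (x t ω) - gradient f (u t ω)‖ ^ 2)
    (V := fun ω => (2 * α t) • (gradient f (x t ω) - (α t * L) • gradient f (u t ω)))
    ((((hdiff.continuous.comp_stronglyMeasurable (hxad t)).const_mul 2).sub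
      ((hgx.norm.pow 2).const_mul _)).add (((hgx.sub hgu).norm.pow 2).const_mul _))
    ((hgx.sub (hgu.fun_const_smul _)).fun_const_smul _) (hζint t) (hζmean t)
    (ae_of_all _ fun ω => by
      have hd := le_add_inner_gradient_add_of_gradient_lipschitz hdiff hlip (x t ω)
        (-(α t • (gradient f (u t ω) - ζ t ω)))
      simp only [Pi.sub_apply, hrec t]
      rw [← sub_eq_add_neg, inner_neg_right, inner_smul_right, inner_sub_right, norm_neg,
        norm_smul, mul_pow, norm_sub_sq_real, Real.norm_eq_abs, sq_abs] at hd
      rw [norm_sub_sq_real, inner_smul_left, inner_sub_left, inner_smul_left]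
      simp only [conj_trivial]
      nlinarith [mul_nonneg (mul_nonneg (hα t).le (sub_nonneg.2 (hαL t)))
        (sq_nonneg ‖gradient f (u t ω)‖)])
  filter_upwards [key, condExp_sub hY hQ (ℱ t),
    condExp_smul (μ := μ) (2 : ℝ) (fun ω => f (x (t + 1) ω)) (ℱ t),
    condExp_smul (μ := μ) ((α t) ^ 2 * L) (fun ω => ‖ζ t ω‖ ^ 2) (ℱ t), hζvar t]
    with ω h1 h2 h3 h4 h5
  simp only [Pi.sub_apply, Pi.smul_apply, smul_eq_mul] at h2 h3 h4
  change (μ[fun ω => 2 * f (x (t + 1) ω) | ℱ t]) ω = _ at h3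
  change (μ[fun ω => (α t) ^ 2 * L * ‖ζ t ω‖ ^ 2 | ℱ t]) ω = _ at h4
  rw [h2, h3, h4] at h1
  linarith [mul_le_mul_of_nonneg_left h5 (by positivity : 0 ≤ (α t) ^ 2 * L)]
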